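/- For every integer k ≥ 1, the node searching number of G_k is at most k + 2, i.e., there exists a search strategy for G_k of cost k + 2. -/

import Mathlib

namespace NodeSearch

/-- A move in the node searching game: place a guard on a vertex or remove one. -/
inductive Move (V : Type*) where
  | place (v : V)
  | remove (v : V)

variable {V : Type*} [DecidableEq V]

/-- The effect of a move on the current set of guarded vertices. -/
def applyMove (U : Finset V) : Move V → Finset V
  | .place v => insert v U
  | .remove v => U.erase v

/-- The set of guarded vertices after the first `i` moves (initially there are no guards). -/
def guardsAt (ms : List (Move V)) (i : ℕ) : Finset V :=
  (ms.take i).foldl applyMove ∅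

/-- Contamination spreads from the edges in `Z` along shared endpoints that are not guarded
(i.e. not in `U`). -/
inductive Spread (G : SimpleGraph V) (U : Finset V) (Z : Set (Sym2 V)) : Sym2 V → Prop where
  | base (e : Sym2 V) (he : e ∈ Z) : Spread G U Z e
  | step (e e' : Sym2 V) (w : V) (hw : w ∉ U) (hwe : w ∈ e) (hwe' : w ∈ e')
      (he' : e' ∈ G.edgeSet) (h : Spread G U Z e) : Spread G U Z e'

/-- The contaminated edges after a move resulting in guard set `U`, given that the
contaminated edges were `Z` before: edges with both endpoints guarded become clean,
and contamination spreads through unguarded shared endpoints. -/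
def nextContam (G : SimpleGraph V) (U : Finset V) (Z : Set (Sym2 V)) : Set (Sym2 V) :=
  {e | Spread G U (Z \ {e | ∀ v ∈ e, v ∈ U}) e}

/-- The set of contaminated edges after the first `i` moves; initially all edges
are contaminated. -/
def contamAt (G : SimpleGraph V) (ms : List (Move V)) : ℕ → Set (Sym2 V)
  | 0 => G.edgeSet
  | i + 1 => nextContam G (guardsAt ms (i + 1)) (contamAt G ms i)

/-- A search strategy: a sequence of moves after which every edge is clean. -/
def IsStrategy (G : SimpleGraph V) (ms : List (Move V)) : Prop :=
  contamAt G ms ms.length = ∅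

/-- The cost of a sequence of moves: the maximum number of guards present at any time. -/
def cost (ms : List (Move V)) : ℕ :=
  (Finset.range (ms.length + 1)).sup fun i => (guardsAt ms i).card

/-- The node searching number of `G`: the minimum cost of a search strategy. -/
noncomputable def ns (G : SimpleGraph V) : ℕ :=
  sInf {c | ∃ ms : List (Move V), IsStrategy G ms ∧ cost ms = c}

/-- A sequence of moves causes no recontamination iff the set of contaminated edges
only ever shrinks. -/
def RecontFree (G : SimpleGraph V) (ms : List (Move V)) : Prop :=
  ∀ i < ms.length, contamAt G ms (i + 1) ⊆ contamAt G ms i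

end NodeSearch

/-- The vertices of the graph `G_k`: pairs `(x, y)` with `x ∈ {1, …, k+2}` and
`y ∈ {1, …, 3k+6}`. -/
abbrev GkVert (k : ℕ) : Type :=
  {p : ℕ × ℕ // p ∈ Finset.Icc 1 (k + 2) ×ˢ Finset.Icc 1 (3 * k + 6)}

/-- The graph `G_k` on `{1, …, k+2} × {1, …, 3k+6}`, with column edges
`{(x,y), (x+1,y)}` for `x ∈ {1, …, k+1}` and row edges `{(x,y), (x,y+1)}`
for `x ∈ {1, …, k}`. -/
def Gk (k : ℕ) : SimpleGraph (GkVert k) :=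
  SimpleGraph.fromRel fun p q =>
    (q.val.1 = p.val.1 + 1 ∧ q.val.2 = p.val.2) ∨
    (p.val.1 = q.val.1 ∧ p.val.1 ≤ k ∧ q.val.2 = p.val.2 + 1)

namespace NodeSearch

section general

variable {V : Type*} [DecidableEq V]

lemma guardsAt_append (ms : List (Move V)) (m : Move V) (i : ℕ) (hi : i ≤ ms.length) :
    guardsAt (ms ++ [m]) i = guardsAt ms i := by
  unfold guardsAt
  rw [List.take_append_of_le_length hi]

lemma guardsAt_append_last (ms : List (Move V)) (m : Move V) :
    guardsAt (ms ++ [m]) (ms.length + 1) = applyMove (guardsAt ms ms.length) m := by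
  unfold guardsAt
  rw [List.take_of_length_le (by simp), List.take_of_length_le (by simp)]
  simp

lemma contamAt_append (G : SimpleGraph V) (ms : List (Move V)) (m : Move V) (i : ℕ)
    (hi : i ≤ ms.length) : contamAt G (ms ++ [m]) i = contamAt G ms i := by
  induction i with
  | zero => rfl
  | succ i ih =>
    simp only [contamAt]
    rw [ih (by omega), guardsAt_append _ _ _ hi]

lemma cost_append (ms : List (Move V)) (m : Move V) (c : ℕ) (h : cost ms ≤ c)
    (h' : (applyMove (guardsAt ms ms.length) m).card ≤ c) : cost (ms ++ [m]) ≤ c := by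
  unfold cost at *
  rw [Finset.sup_le_iff] at *
  intro i hi
  simp only [List.length_append, List.length_singleton, Finset.mem_range] at hi
  by_cases h1 : i ≤ ms.length
  · rw [guardsAt_append _ _ _ h1]
    exact h i (by simp; omega)
  · have : i = ms.length + 1 := by omega
    subst this
    rw [guardsAt_append_last]
    exact h'

/-- The edges not contained in `P`. -/
def outside (G : SimpleGraph V) (P : Set V) : Set (Sym2 V) :=
  {e | e ∈ G.edgeSet ∧ ∃ v ∈ e, v ∉ P}

/-- A state reachable within cost `c`, with guards `U` and everything in `P` clean. -/
def Reach (G : SimpleGraph V) (c : ℕ) (P : Set V) (U : Finset V) : Prop :=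
  (∃ ms : List (Move V), guardsAt ms ms.length = U ∧
    contamAt G ms ms.length ⊆ outside G P ∧ cost ms ≤ c) ∧
  (∀ v ∈ P, v ∉ U → ∀ w, G.Adj v w → w ∈ P)

lemma nextContam_sub (G : SimpleGraph V) (P : Set V) (U : Finset V) (Z : Set (Sym2 V))
    (hZ : ∀ e ∈ Z, (¬ ∀ v ∈ e, v ∈ U) → e ∈ outside G P)
    (hP : ∀ v ∈ P, v ∉ U → ∀ w, G.Adj v w → w ∈ P) :
    nextContam G U Z ⊆ outside G P := by
  intro e he
  change Spread G U _ e at he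
  induction he with
  | base e he => exact hZ e he.1 he.2
  | step e e' w hw hwe hwe' he' _ ih =>
    refine ⟨he', w, hwe', fun hwP => ?_⟩
    obtain ⟨hG, v, hv, hvP⟩ := ih
    obtain ⟨u, rfl⟩ := hwe
    rw [SimpleGraph.mem_edgeSet] at hG
    rw [Sym2.mem_iff] at hv
    rcases hv with rfl | rfl
    · exact hvP hwP
    · exact hvP (hP w hwP hw v hG)

lemma Reach.step {G : SimpleGraph V} {c : ℕ} {P P' : Set V} {U : Finset V} (m : Move V)
    (h : Reach G c P U) (hc : (applyMove U m).card ≤ c)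
    (hZ : ∀ e ∈ outside G P, (¬ ∀ v ∈ e, v ∈ applyMove U m) → e ∈ outside G P')
    (hP : ∀ v ∈ P', v ∉ applyMove U m → ∀ w, G.Adj v w → w ∈ P') :
    Reach G c P' (applyMove U m) := by
  obtain ⟨⟨ms, rfl, h2, h3⟩, -⟩ := h
  refine ⟨⟨ms ++ [m], ?_, ?_, cost_append _ _ _ h3 hc⟩, hP⟩
  · simp [guardsAt_append_last]
  · simp only [List.length_append, List.length_singleton, contamAt]
    rw [guardsAt_append_last, contamAt_append _ _ _ _ le_rfl]
    exact nextContam_sub _ _ _ _ (fun e he => hZ e (h2 he)) hP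

lemma Reach.place {G : SimpleGraph V} {c : ℕ} {P : Set V} {U : Finset V} (v : V)
    (h : Reach G c P U) (hc : (insert v U).card ≤ c) :
    Reach G c (insert v P) (insert v U) := by
  have hP := h.2
  refine h.step (Move.place v) hc ?_ ?_
  · rintro e ⟨hG, a, ha, haP⟩ hU
    refine ⟨hG, ?_⟩
    by_contra hcon
    push Not at hcon
    have hav : a = v := by
      rcases hcon a ha with h1 | h1
      · exact h1
      · exact absurd h1 haP
    subst hav
    apply hU
    obtain ⟨b, rfl⟩ := ha
    intro w hw
    change w ∈ insert a U
    rcases hcon w hw with h1 | h1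
    · simp [h1]
    · rw [Finset.mem_insert]
      right
      by_contra hwU
      rcases Sym2.mem_iff.1 hw with rfl | rfl
      · exact haP h1
      · exact haP (hP w h1 hwU a (SimpleGraph.Adj.symm hG))
  · intro a ha haU w hw
    change a ∉ insert v U at haU
    rw [Finset.mem_insert, not_or] at haU
    rcases ha with h1 | h1
    · exact absurd h1 haU.1
    · exact Or.inr (hP a h1 haU.2 w hw)

lemma Reach.shrink {G : SimpleGraph V} {c : ℕ} {P : Set V} {U U' : Finset V}
    (h : Reach G c P U) (hc : U.card ≤ c) (hU : U' ⊆ U)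
    (hP : ∀ v ∈ P, v ∉ U' → ∀ w, G.Adj v w → w ∈ P) : Reach G c P U' := by
  induction hn : (U \ U').card generalizing U with
  | zero =>
    have : U ⊆ U' := by
      rw [← Finset.sdiff_eq_empty_iff_subset]; exact Finset.card_eq_zero.1 hn
    rwa [Finset.Subset.antisymm hU this]
  | succ n ih =>
    obtain ⟨v, hv⟩ := Finset.card_pos.1 (by omega : 0 < (U \ U').card)
    have hv' := Finset.mem_sdiff.1 hv
    have hsub : U' ⊆ U.erase v := fun w hw =>
      Finset.mem_erase.2 ⟨fun e => hv'.2 (e ▸ hw), hU hw⟩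
    have hle : (U.erase v).card ≤ c := (Finset.card_le_card (Finset.erase_subset _ _)).trans hc
    refine ih (U := U.erase v) (h.step (Move.remove v) hle (fun e he _ => he) ?_) hle hsub ?_
    · intro a ha haU
      exact hP a ha (fun h => haU (hsub h))
    · have : U.erase v \ U' = (U \ U').erase v := by
        ext; simp; tauto
      rw [this, Finset.card_erase_of_mem hv]; omega

lemma Reach.pad [Fintype V] {G : SimpleGraph V} {c : ℕ} {U : Finset V}
    (h : Reach G c Set.univ U) (hc : U.card ≤ c) (hV : c ≤ Fintype.card V) :
    ∃ ms : List (Move V), IsStrategy G ms ∧ cost ms = c := by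
  induction hn : c - U.card generalizing U with
  | zero =>
    obtain ⟨⟨ms, rfl, h2, h3⟩, -⟩ := h
    refine ⟨ms, ?_, le_antisymm h3 ?_⟩
    · refine Set.subset_empty_iff.1 (h2.trans ?_)
      rintro e ⟨_, v, _, hv⟩
      exact hv (Set.mem_univ v)
    · have : (guardsAt ms ms.length).card ≤ cost ms :=
        Finset.le_sup (f := fun i => (guardsAt ms i).card) (by simp)
      omega
  | succ n ih =>
    have : ∃ v, v ∉ U := by
      by_contra hcon
      push Not at hcon
      have : U = Finset.univ := by ext; simp [hcon]
      rw [this, Finset.card_univ] at hn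
      omega
    obtain ⟨v, hv⟩ := this
    have hcard := Finset.card_insert_of_notMem hv
    have h' := h.place v (by omega)
    rw [Set.insert_eq_of_mem (Set.mem_univ v)] at h'
    exact ih h' (by omega) (by omega)

lemma reach_nil (G : SimpleGraph V) (c : ℕ) : Reach G c ∅ ∅ := by
  refine ⟨⟨[], rfl, ?_, ?_⟩, by simp⟩
  · intro e he
    refine ⟨he, ?_⟩
    induction e with
    | _ a b => exact ⟨a, by simp, by simp⟩
  · simp [cost, guardsAt]

end general

end NodeSearch

section grid

/-- Position of a vertex in the column by column order. -/
def gkKey (k : ℕ) (v : GkVert k) : ℕ := (v.val.2 - 1) * (k + 2) + (v.val.1 - 1)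

/-- The guards kept after handling the first `t` positions. -/
def gkGuards (k t : ℕ) : Finset (GkVert k) :=
  Finset.univ.filter fun v => v.val.1 ≤ k + 1 ∧ gkKey k v < t ∧ t ≤ gkKey k v + (k + 2)

lemma gk_bounds (k : ℕ) (v : GkVert k) :
    1 ≤ v.val.1 ∧ v.val.1 ≤ k + 2 ∧ 1 ≤ v.val.2 ∧ v.val.2 ≤ 3 * k + 6 := by
  have h := v.2
  simp only [Finset.mem_product, Finset.mem_Icc] at h
  tauto

lemma gkKey_inj (k : ℕ) : Function.Injective (gkKey k) := by
  intro v w h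
  have hv := gk_bounds k v
  have hw := gk_bounds k w
  unfold gkKey at h
  have h1 := congrArg (· % (k + 2)) h
  have h2 := congrArg (· / (k + 2)) h
  simp only [Nat.mul_add_mod_self_right] at h1
  rw [Nat.mod_eq_of_lt (by omega), Nat.mod_eq_of_lt (by omega)] at h1
  have h3 : (v.val.2 - 1) * (k + 2) = (w.val.2 - 1) * (k + 2) := by omega
  have h4 := Nat.eq_of_mul_eq_mul_right (by omega) h3
  apply Subtype.ext
  apply Prod.ext <;> omega

lemma gkGuards_card (k t : ℕ) : (gkGuards k t).card ≤ k + 1 := by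
  have : (gkGuards k t).card ≤ (Finset.Icc 1 (k + 1)).card := by
    refine Finset.card_le_card_of_injOn (fun v => v.val.1) ?_ ?_
    · intro v hv
      have hb := gk_bounds k v
      simp [gkGuards] at hv
      simp
      omega
    · intro v hv w hw hvw
      simp only [gkGuards, Finset.coe_filter, Finset.mem_univ, true_and, Set.mem_ofPred_eq] at hv hw
      have hbv := gk_bounds k v
      have hbw := gk_bounds k w
      simp only at hvw
      unfold gkKey at hv hw
      rw [hvw] at hv
      have h1 : v.val.2 - 1 = w.val.2 - 1 := by
        rcases lt_trichotomy (v.val.2 - 1) (w.val.2 - 1) with h | h | h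
        · have := Nat.mul_le_mul_right (k + 2) (Nat.succ_le_of_lt h)
          rw [Nat.succ_mul] at this
          omega
        · exact h
        · have := Nat.mul_le_mul_right (k + 2) (Nat.succ_le_of_lt h)
          rw [Nat.succ_mul] at this
          omega
      apply Subtype.ext
      apply Prod.ext <;> omega
  simpa using this

lemma gk_adj (k : ℕ) (v w : GkVert k) (h : (Gk k).Adj v w) :
    gkKey k w ≤ gkKey k v + (k + 2) ∧ (v.val.1 = k + 2 → gkKey k w < gkKey k v) := by
  have hbv := gk_bounds k v
  have hbw := gk_bounds k w
  unfold Gk at h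
  rw [SimpleGraph.fromRel_adj] at h
  unfold gkKey
  rcases h.2 with (⟨h1, h2⟩ | ⟨h1, h2, h3⟩) | (⟨h1, h2⟩ | ⟨h1, h2, h3⟩)
  · rw [h2]; omega
  · have : w.val.2 - 1 = (v.val.2 - 1) + 1 := by omega
    rw [this, Nat.succ_mul (_ - 1) (k + 2)]; omega
  · rw [h2]; omega
  · have : v.val.2 - 1 = (w.val.2 - 1) + 1 := by omega
    rw [this, Nat.succ_mul (_ - 1) (k + 2)]; omega

lemma gk_closed (k t : ℕ) : ∀ v ∈ {v | gkKey k v < t}, v ∉ gkGuards k t →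
    ∀ w, (Gk k).Adj v w → w ∈ {v | gkKey k v < t} := by
  intro v hv hvU w hw
  have h := gk_adj k v w hw
  have hb := gk_bounds k v
  simp only [gkGuards, Finset.mem_filter, Finset.mem_univ, true_and, Set.mem_ofPred_eq] at *
  by_cases hx : v.val.1 = k + 2
  · have := h.2 hx; omega
  · have := h.1; omega

lemma gk_reach (k t : ℕ) :
    NodeSearch.Reach (Gk k) (k + 2) {v | gkKey k v < t} (gkGuards k t) := by
  induction t with
  | zero =>
    have h1 : {v | gkKey k v < 0} = (∅ : Set (GkVert k)) := by ext; simp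
    have h2 : gkGuards k 0 = ∅ := by simp [gkGuards]
    rw [h1, h2]
    exact NodeSearch.reach_nil _ _
  | succ t ih =>
    have hcard := gkGuards_card k t
    by_cases hex : ∃ v, gkKey k v = t
    · obtain ⟨v, hv⟩ := hex
      have hins := (Finset.card_insert_le v (gkGuards k t)).trans (by omega : _ ≤ k + 2)
      have h := ih.place v hins
      have hP : insert v {v | gkKey k v < t} = {v | gkKey k v < t + 1} := by
        ext w
        simp only [Set.mem_insert_iff, Set.mem_ofPred_eq]
        rw [← (gkKey_inj k).eq_iff, hv]
        omega
      rw [hP] at h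
      refine h.shrink hins ?_ (gk_closed k (t + 1))
      intro w hw
      rw [Finset.mem_insert, ← (gkKey_inj k).eq_iff, hv]
      simp only [gkGuards, Finset.mem_filter, Finset.mem_univ, true_and] at hw ⊢
      omega
    · have hne : ∀ w, gkKey k w ≠ t := fun w hw => hex ⟨w, hw⟩
      have hP : {v | gkKey k v < t} = {v | gkKey k v < t + 1} := by
        ext w
        have := hne w
        simp only [Set.mem_ofPred_eq]
        omega
      rw [hP] at ih
      refine ih.shrink (by omega) ?_ (gk_closed k (t + 1))
      intro w hw
      have := hne w
      simp only [gkGuards, Finset.mem_filter, Finset.mem_univ, true_and] at hw ⊢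
      omega

end grid

theorem stmt4 (k : ℕ) (hk : 1 ≤ k) :
    NodeSearch.ns (Gk k) ≤ k + 2 ∧
      ∃ ms : List (NodeSearch.Move (GkVert k)),
        NodeSearch.IsStrategy (Gk k) ms ∧ NodeSearch.cost ms = k + 2 := by
  have key : ∃ ms : List (NodeSearch.Move (GkVert k)),
      NodeSearch.IsStrategy (Gk k) ms ∧ NodeSearch.cost ms = k + 2 := by
    have h := gk_reach k (Finset.univ.sup (gkKey k) + 1)
    have hP : {v | gkKey k v < Finset.univ.sup (gkKey k) + 1} = Set.univ := by
      ext w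
      simp only [Set.mem_ofPred_eq, Set.mem_univ, iff_true]
      exact Nat.lt_succ_of_le (Finset.le_sup (Finset.mem_univ w))
    rw [hP] at h
    refine h.pad ((gkGuards_card _ _).trans (by omega)) ?_
    rw [Fintype.card_coe, Finset.card_product]
    simp only [Nat.card_Icc, Nat.add_sub_cancel]
    exact Nat.le_mul_of_pos_right _ (by omega)
  exact ⟨Nat.sInf_le key, key⟩
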